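/- arXiv:1606.01576 — 3 statements merged into one kernel-verified Lean document; each statement's English description precedes it below -/
import Mathlib

section
/- Let a₁, a₂, b₁ ∈ ℝ with b₁ not equal to any nonpositive integer, and for x ∈ (−1, 1) let F(x) = ∑_{k=0}^∞ ((a₁)_k·(a₂)_k / ((b₁)_k·k!))·x^k. Then for every x ∈ (−1, 1), x·(1 − x)·F''(x) + (b₁ − (a₁ + a₂ + 1)·x)·F'(x) − a₁·a₂·F(x) = 0. -/
open Filter Topology Set in
theorem summable_deriv_coeff_mul_pow {c : ℕ → ℝ}
    (hc : ∀ x ∈ Ioo (-1 : ℝ) 1, Summable fun k => c k * x ^ k) :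
    ∀ x ∈ Ioo (-1 : ℝ) 1, Summable fun k : ℕ => ((k + 1 : ℕ) : ℝ) * c (k + 1) * x ^ k := by
  intro x hx
  obtain ⟨r, hxr, hr1⟩ := exists_between (abs_lt.2 hx)
  have hr0 : 0 < r := (abs_nonneg x).trans_lt hxr
  have hb := (hc r ⟨by linarith, hr1⟩).tendsto_atTop_zero.isBigO_one ℝ
  have hb' : (fun k => c (k + 1) * r ^ (k + 1)) =O[atTop] fun _ => (1 : ℝ) :=
    hb.comp_tendsto (tendsto_add_atTop_nat 1)
  have hgeom : Summable fun k : ℕ => ((k + 1 : ℕ) : ℝ) * (x / r) ^ k := by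
    have hn : ‖x / r‖ < 1 := by
      rw [Real.norm_eq_abs, abs_div, abs_of_pos hr0]
      exact (div_lt_one hr0).2 hxr
    have h1 := summable_pow_mul_geometric_of_norm_lt_one 1 hn
    refine (h1.add (summable_geometric_of_norm_lt_one hn)).congr fun k => ?_
    push_cast
    ring
  refine summable_of_isBigO_nat hgeom.norm ?_
  have h := ((Asymptotics.isBigO_refl
    (fun k : ℕ => ((k + 1 : ℕ) : ℝ) * (x / r) ^ k) atTop).norm_right.mul hb').const_mul_left r⁻¹
  refine (h.congr (fun k => ?_) fun k => mul_one _)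
  rw [div_pow, pow_succ]
  field_simp

open Set in
theorem hasDerivAt_tsum_coeff_mul_pow {c : ℕ → ℝ}
    (hc : ∀ x ∈ Ioo (-1 : ℝ) 1, Summable fun k => c k * x ^ k) {x : ℝ} (hx : x ∈ Ioo (-1 : ℝ) 1) :
    HasDerivAt (fun y => ∑' k, c k * y ^ k)
      (∑' k : ℕ, ((k + 1 : ℕ) : ℝ) * c (k + 1) * x ^ k) x := by
  obtain ⟨r, hxr, hr1⟩ := exists_between (abs_lt.2 hx)
  have hr0 : 0 < r := (abs_nonneg x).trans_lt hxr
  have hder : ∀ y ∈ Ioo (-1 : ℝ) 1, Summable fun k : ℕ => c k * ((k : ℝ) * y ^ (k - 1)) :=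
    fun y hy => (summable_nat_add_iff 1).1 <|
      (summable_deriv_coeff_mul_pow hc y hy).congr fun k => by
        rw [Nat.add_sub_cancel]
        ring
  have key := hasDerivAt_tsum_of_isPreconnected (t := Ioo (-r) r)
    (g := fun k y => c k * y ^ k) (g' := fun k y => c k * ((k : ℝ) * y ^ (k - 1)))
    (hder r ⟨by linarith, hr1⟩).norm isOpen_Ioo isPreconnected_Ioo
    (fun k y _ => (hasDerivAt_pow k y).const_mul (c k)) (fun k y hy => ?_)
    (y₀ := 0) ⟨by linarith, hr0⟩ (hc 0 (by simp)) (abs_lt.1 hxr)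
  · refine key.congr_deriv ?_
    rw [(hder x hx).tsum_eq_zero_add]
    simp only [Nat.cast_zero, zero_mul, mul_zero, zero_add, Nat.add_sub_cancel]
    exact tsum_congr fun k => by ring
  · have hyr : |y| ≤ |r| := (abs_lt.2 hy).le.trans (le_abs_self r)
    simp only [norm_mul, norm_pow, Real.norm_eq_abs]
    gcongr

open Filter Topology in
theorem summable_mul_pow_of_hypergeometric_recurrence {a₁ a₂ b : ℝ} {c : ℕ → ℝ}
    (hb : ∀ n : ℕ, b ≠ -(n : ℝ))
    (hrec : ∀ k : ℕ, (b + k) * (k + 1) * c (k + 1) = (a₁ + k) * (a₂ + k) * c k) :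
    ∀ x ∈ Set.Ioo (-1 : ℝ) 1, Summable fun k => c k * x ^ k := by
  intro x hx
  obtain ⟨r, hxr, hr1⟩ := exists_between (abs_lt.2 hx)
  have hlin : ∀ a b : ℝ, Tendsto (fun k : ℕ => (a + k) / (b + k)) atTop (𝓝 1) := fun a b => by
    simpa using tendsto_add_mul_div_add_mul_atTop_nhds a b 1 (one_ne_zero (α := ℝ))
  have hlim := ((((hlin a₁ b).mul (hlin a₂ 1)).mul_const x).norm)
  rw [one_mul, one_mul, Real.norm_eq_abs] at hlim
  refine summable_of_ratio_norm_eventually_le hr1 ?_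
  filter_upwards [hlim.eventually_lt_const hxr] with k hk
  have hbk : b + k ≠ 0 := fun h => hb k (by linarith)
  have hk1 : (1 : ℝ) + k ≠ 0 := by positivity
  have hterm : c (k + 1) * x ^ (k + 1)
      = (a₁ + k) / (b + k) * ((a₂ + k) / (1 + k)) * x * (c k * x ^ k) := by
    field_simp
    linear_combination x ^ (k + 1) * hrec k
  rw [hterm, norm_mul]
  gcongr

theorem gauss_hypergeometric_series_solves_GHDO
    (a₁ a₂ b₁ : ℝ)
    (hb : ∀ n : ℕ, b₁ ≠ -(n : ℝ))
    (F : ℝ → ℝ)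
    (hF : F = fun x : ℝ => ∑' k : ℕ,
      (Polynomial.eval a₁ (ascPochhammer ℝ k) * Polynomial.eval a₂ (ascPochhammer ℝ k)
        / (Polynomial.eval b₁ (ascPochhammer ℝ k) * (Nat.factorial k : ℝ))) * x ^ k) :
    ∀ x ∈ Set.Ioo (-1 : ℝ) 1,
      x * (1 - x) * deriv (deriv F) x
        + (b₁ - (a₁ + a₂ + 1) * x) * deriv F x
        - a₁ * a₂ * F x = 0 := by
  intro x hx
  set c : ℕ → ℝ := fun k =>
    Polynomial.eval a₁ (ascPochhammer ℝ k) * Polynomial.eval a₂ (ascPochhammer ℝ k)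
      / (Polynomial.eval b₁ (ascPochhammer ℝ k) * (Nat.factorial k : ℝ)) with hc
  have hrec : ∀ k : ℕ, (b₁ + k) * (k + 1) * c (k + 1) = (a₁ + k) * (a₂ + k) * c k := fun k => by
    have hbk : b₁ + k ≠ 0 := fun h => hb k (by linarith)
    have hpk : Polynomial.eval b₁ (ascPochhammer ℝ k) ≠ 0 := fun h => by
      obtain ⟨n, -, hn⟩ := (ascPochhammer_eval_eq_zero_iff k b₁).1 h
      exact hb n (by linarith)
    have hfk : (Nat.factorial k : ℝ) ≠ 0 := Nat.cast_ne_zero.2 k.factorial_ne_zero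
    have hk1 : (k : ℝ) + 1 ≠ 0 := by positivity
    simp only [hc, ascPochhammer_succ_eval, Nat.factorial_succ, Nat.cast_mul, Nat.cast_succ]
    field_simp
  have hs₀ := summable_mul_pow_of_hypergeometric_recurrence hb hrec
  have hs₁ := summable_deriv_coeff_mul_pow hs₀
  have hs₂ := summable_deriv_coeff_mul_pow hs₁
  have hd₁ : Set.EqOn (deriv F) (fun y => ∑' k : ℕ, ((k + 1 : ℕ) : ℝ) * c (k + 1) * y ^ k)
      (Set.Ioo (-1) 1) := fun y hy => by
    rw [hF]
    exact (hasDerivAt_tsum_coeff_mul_pow hs₀ hy).deriv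
  have hd₂ := ((hd₁.eventuallyEq_of_mem (isOpen_Ioo.mem_nhds hx)).deriv_eq).trans
    (hasDerivAt_tsum_coeff_mul_pow hs₁ hx).deriv
  have h₀ : HasSum (fun k => c k * x ^ k) (F x) := by
    rw [hF]
    exact (hs₀ x hx).hasSum
  have h₁ := (hs₁ x hx).hasSum_iff.2 (hd₁ hx).symm
  have h₂ := (hs₂ x hx).hasSum_iff.2 hd₂.symm
  have hx₁ : HasSum (fun k : ℕ => k * c k * x ^ k) (x * deriv F x) := by
    rw [← hasSum_nat_add_iff' 1]
    simpa [pow_succ, mul_comm, mul_left_comm, mul_assoc] using h₁.mul_left x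
  have hx₂ : HasSum (fun k : ℕ => k * ((k + 1) * c (k + 1)) * x ^ k) (x * deriv (deriv F) x) := by
    rw [← hasSum_nat_add_iff' 1]
    simpa [pow_succ, mul_comm, mul_left_comm, mul_assoc] using h₂.mul_left x
  have hxx₂ : HasSum (fun k : ℕ => k * (k - 1) * c k * x ^ k)
      (x * (x * deriv (deriv F) x)) := by
    rw [← hasSum_nat_add_iff' 1]
    simpa [pow_succ, mul_comm, mul_left_comm, mul_assoc] using hx₂.mul_left x
  have hsum := (((hx₂.add (h₁.mul_left b₁)).sub hxx₂).sub (hx₁.mul_left (a₁ + a₂ + 1))).sub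
    (h₀.mul_left (a₁ * a₂))
  have hzero := hsum.unique (hasSum_zero.congr_fun fun k => ?_)
  · linear_combination hzero
  · push_cast
    linear_combination x ^ k * hrec k
end

section
/- For x ∈ (0, 1), let Y(x) = (x+1)^(−5/21) · ∑_{k=0}^∞ ((5/42)_k·(11/42)_k / ((2/3)_k·k!))·(4x/(x+1)²)^k, where (x+1)^(−5/21) denotes the real power. Then Y is twice differentiable on (0, 1) and 147·x·(x−1)·(x+1)·Y''(x) + (266·x² − 42·x − 98)·Y'(x) + (20·x − 5)·Y(x) = 0 for all x ∈ (0, 1). -/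
section PowerSeries

variable {c : ℕ → ℝ}

/-- If a real power series converges absolutely on `(-1, 1)`, so does its formal derivative. -/
lemma summable_abs_derivCoeff
    (hc : ∀ r : ℝ, 0 ≤ r → r < 1 → Summable fun n => |c n| * r ^ n)
    (r : ℝ) (hr0 : 0 ≤ r) (hr1 : r < 1) :
    Summable fun n : ℕ => |((n : ℝ) + 1) * c (n + 1)| * r ^ n := by
  obtain ⟨s, hrs, hs1⟩ := exists_between hr1
  have hs0 : 0 < s := hr0.trans_lt hrs
  have hq0 : 0 ≤ r / s := by positivity
  have hq1 : r / s < 1 := (div_lt_one hs0).2 hrs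
  have hsum := (summable_nat_add_iff 1).2 (hc s hs0.le hs1)
  have hbdd : BddAbove (Set.range fun n : ℕ => (n : ℝ) * (r / s) ^ n + (r / s) ^ n) :=
    ((tendsto_self_mul_const_pow_of_lt_one hq0 hq1).add
      (tendsto_pow_atTop_nhds_zero_of_lt_one hq0 hq1)).bddAbove_range
  obtain ⟨K, hK⟩ := hbdd
  refine Summable.of_nonneg_of_le (fun n => by positivity) (fun n => ?_) (hsum.mul_left (K / s))
  have hKn : (n : ℝ) * (r / s) ^ n + (r / s) ^ n ≤ K := hK ⟨n, rfl⟩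
  have hpos : (0 : ℝ) ≤ (n : ℝ) + 1 := by positivity
  calc |((n : ℝ) + 1) * c (n + 1)| * r ^ n
      = ((n : ℝ) * (r / s) ^ n + (r / s) ^ n) * (|c (n + 1)| * s ^ n) := by
        rw [abs_mul, abs_of_nonneg hpos, div_pow]
        field_simp
    _ ≤ K * (|c (n + 1)| * s ^ n) := by gcongr
    _ = K / s * (|c (n + 1)| * s ^ (n + 1)) := by
        field_simp
        ring

lemma summable_mul_pow_of_abs_lt_one
    (hc : ∀ r : ℝ, 0 ≤ r → r < 1 → Summable fun n => |c n| * r ^ n) {z : ℝ} (hz : |z| < 1) :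
    Summable fun n => c n * z ^ n := by
  refine Summable.of_norm ?_
  simpa only [norm_mul, norm_pow, Real.norm_eq_abs] using hc |z| (abs_nonneg z) hz

lemma hasDerivAt_tsum_mul_pow
    (hc : ∀ r : ℝ, 0 ≤ r → r < 1 → Summable fun n => |c n| * r ^ n) {z : ℝ} (hz : |z| < 1) :
    HasDerivAt (fun w => ∑' n, c n * w ^ n)
      (∑' n : ℕ, (((n : ℝ) + 1) * c (n + 1)) * z ^ n) z := by
  obtain ⟨r, hzr, hr1⟩ := exists_between hz
  have hr0 : 0 < r := (abs_nonneg z).trans_lt hzr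
  have hu : Summable fun n : ℕ => |(n : ℝ) * c n| * r ^ (n - 1) := by
    rw [← summable_nat_add_iff 1]
    simpa using summable_abs_derivCoeff hc r hr0.le hr1
  have hz' : z ∈ Set.Ioo (-r) r := abs_lt.1 hzr
  have hderiv : HasDerivAt (fun w => ∑' n, c n * w ^ n)
      (∑' n : ℕ, c n * (n * z ^ (n - 1))) z := by
    refine hasDerivAt_tsum_of_isPreconnected hu isOpen_Ioo isPreconnected_Ioo
      (fun n y _ => (hasDerivAt_pow n y).const_mul (c n)) (fun n y hy => ?_) hz'
      (summable_mul_pow_of_abs_lt_one hc hz) hz'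
    have hy' : |y| ≤ r := (abs_lt.2 hy).le
    rw [Real.norm_eq_abs, ← mul_assoc, abs_mul, abs_pow, mul_comm (c n)]
    gcongr
  have hs : Summable fun n : ℕ => c n * (n * z ^ (n - 1)) := by
    rw [← summable_nat_add_iff 1]
    refine (summable_mul_pow_of_abs_lt_one (summable_abs_derivCoeff hc) hz).congr fun n => ?_
    push_cast [Nat.add_sub_cancel]
    ring
  rw [hs.tsum_eq_zero_add] at hderiv
  convert hderiv using 1
  simp only [Nat.cast_zero, zero_mul, mul_zero, zero_add]
  refine tsum_congr fun n => ?_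
  push_cast [Nat.add_sub_cancel]
  ring

lemma HasSum.mul_pow_shift {g : ℕ → ℝ} {z s : ℝ} (h : HasSum (fun n => g (n + 1) * z ^ n) s)
    (hg : g 0 = 0) : HasSum (fun n => g n * z ^ n) (z * s) := by
  rw [← hasSum_nat_add_iff' 1]
  simp only [Finset.range_one, Finset.sum_singleton, hg, zero_mul, sub_zero]
  refine (h.mul_left z).congr_fun fun n => ?_
  ring

lemma HasSum.natCast_mul_pow {z s : ℝ}
    (h : HasSum (fun n : ℕ => ((n : ℝ) + 1) * c (n + 1) * z ^ n) s) :
    HasSum (fun n : ℕ => (n : ℝ) * c n * z ^ n) (z * s) :=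
  HasSum.mul_pow_shift (g := fun n : ℕ => (n : ℝ) * c n) (by exact_mod_cast h) (by simp)

end PowerSeries

section Hypergeometric

variable {a b c : ℝ}

lemma summable_abs_ordinaryHypergeometricCoefficient
    (habc : ∀ k : ℕ, (k : ℝ) ≠ -a ∧ (k : ℝ) ≠ -b ∧ (k : ℝ) ≠ -c)
    (r : ℝ) (hr0 : 0 ≤ r) (hr1 : r < 1) :
    Summable fun n => |ordinaryHypergeometricCoefficient a b c n| * r ^ n := by
  lift r to NNReal using hr0
  have hrad : (r : ENNReal) < (ordinaryHypergeometricSeries ℝ a b c).radius := by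
    rw [ordinaryHypergeometricSeries_radius_eq_one ℝ a b c habc]
    exact_mod_cast hr1
  simpa [ordinaryHypergeometricSeries, FormalMultilinearSeries.ofScalars_norm] using
    (ordinaryHypergeometricSeries ℝ a b c).summable_norm_mul_pow hrad

lemma ordinaryHypergeometricCoefficient_succ_mul (hc : ∀ k : ℕ, (k : ℝ) ≠ -c) (n : ℕ) :
    ((n : ℝ) + 1) * (c + n) * ordinaryHypergeometricCoefficient a b c (n + 1)
      = (a + n) * (b + n) * ordinaryHypergeometricCoefficient a b c n := by
  have hn : (n : ℝ) + 1 ≠ 0 := by positivity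
  have hcn : c + n ≠ 0 := fun h => hc n (by linarith)
  have hP : (ascPochhammer ℝ n).eval c ≠ 0 := fun h => by
    obtain ⟨k, -, hk⟩ := (ascPochhammer_eval_eq_zero_iff n c).1 h
    exact hc k hk
  have hf : (n.factorial : ℝ) ≠ 0 := by positivity
  simp only [ordinaryHypergeometricCoefficient, ascPochhammer_succ_eval, Nat.factorial_succ]
  push_cast
  field_simp

/-- A power series whose coefficients satisfy the hypergeometric recurrence solves Euler's
hypergeometric differential equation on `(-1, 1)`. -/
lemma tsum_hypergeometric_equation {d d₁ d₂ : ℕ → ℝ}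
    (hd₁ : ∀ n : ℕ, d₁ n = ((n : ℝ) + 1) * d (n + 1))
    (hd₂ : ∀ n : ℕ, d₂ n = ((n : ℝ) + 1) * d₁ (n + 1))
    (hrec : ∀ n : ℕ, ((n : ℝ) + 1) * (c + n) * d (n + 1) = (a + n) * (b + n) * d n)
    {z s s₁ s₂ : ℝ} (h : HasSum (fun n => d n * z ^ n) s)
    (h₁ : HasSum (fun n => d₁ n * z ^ n) s₁) (h₂ : HasSum (fun n => d₂ n * z ^ n) s₂) :
    z * (1 - z) * s₂ + (c - (a + b + 1) * z) * s₁ - a * b * s = 0 := by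
  have hz₁ : HasSum (fun n : ℕ => (n : ℝ) * d n * z ^ n) (z * s₁) :=
    HasSum.natCast_mul_pow (by simpa only [hd₁] using h₁)
  have hz₂ : HasSum (fun n : ℕ => (n : ℝ) * d₁ n * z ^ n) (z * s₂) :=
    HasSum.natCast_mul_pow (by simpa only [hd₂] using h₂)
  have hzz₂ : HasSum (fun n : ℕ => (n : ℝ) * (((n : ℝ) - 1) * d n) * z ^ n) (z * (z * s₂)) := by
    refine HasSum.natCast_mul_pow (c := fun n : ℕ => ((n : ℝ) - 1) * d n)
      (hz₂.congr_fun fun n => ?_)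
    rw [hd₁]
    push_cast
    ring
  have hsum := (((hz₂.sub hzz₂).add (h₁.mul_left c)).sub (hz₁.mul_left (a + b + 1))).sub
    (h.mul_left (a * b))
  have hzero : HasSum (fun n : ℕ => (n : ℝ) * d₁ n * z ^ n - (n : ℝ) * (((n : ℝ) - 1) * d n) * z ^ n
      + c * (d₁ n * z ^ n) - (a + b + 1) * ((n : ℝ) * d n * z ^ n) - a * b * (d n * z ^ n)) 0 := by
    refine hasSum_zero.congr_fun fun n => ?_
    rw [hd₁]
    linear_combination z ^ n * hrec n
  linear_combination hsum.unique hzero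

/-- Euler's hypergeometric differential equation for `₂F₁` on `(-1, 1)`. -/
lemma exists_hasDerivAt_ordinaryHypergeometric
    (habc : ∀ k : ℕ, (k : ℝ) ≠ -a ∧ (k : ℝ) ≠ -b ∧ (k : ℝ) ≠ -c) :
    ∃ F₁ F₂ : ℝ → ℝ, ∀ z : ℝ, |z| < 1 →
      HasDerivAt (₂F₁ a b c) (F₁ z) z ∧ HasDerivAt F₁ (F₂ z) z ∧
      z * (1 - z) * F₂ z + (c - (a + b + 1) * z) * F₁ z - a * b * ₂F₁ a b c z = 0 := by
  have hs := summable_abs_ordinaryHypergeometricCoefficient habc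
  have hrec := ordinaryHypergeometricCoefficient_succ_mul (a := a) (b := b) fun k => (habc k).2.2
  have hF : (₂F₁ a b c : ℝ → ℝ) =
      fun z => ∑' n, ordinaryHypergeometricCoefficient a b c n * z ^ n := by
    simp only [ordinaryHypergeometric_eq_tsum, smul_eq_mul]
  rw [hF]
  generalize ordinaryHypergeometricCoefficient a b c = d at hs hrec
  have hs₁ := summable_abs_derivCoeff hs
  have hs₂ := summable_abs_derivCoeff hs₁
  exact ⟨_, _, fun z hz => ⟨hasDerivAt_tsum_mul_pow hs hz, hasDerivAt_tsum_mul_pow hs₁ hz,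
    tsum_hypergeometric_equation (fun _ => rfl) (fun _ => rfl) hrec
      (summable_mul_pow_of_abs_lt_one hs hz).hasSum
      (summable_mul_pow_of_abs_lt_one hs₁ hz).hasSum
      (summable_mul_pow_of_abs_lt_one hs₂ hz).hasSum⟩⟩

end Hypergeometric

theorem example_hypergeometric_solution
    (Y : ℝ → ℝ)
    (hY : Y = fun x : ℝ => (x + 1) ^ (-(5 : ℝ) / 21) * ∑' k : ℕ,
      (Polynomial.eval ((5 : ℝ)/42) (ascPochhammer ℝ k)
          * Polynomial.eval ((11 : ℝ)/42) (ascPochhammer ℝ k)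
        / (Polynomial.eval ((2 : ℝ)/3) (ascPochhammer ℝ k) * (Nat.factorial k : ℝ)))
        * (4 * x / (x + 1) ^ 2) ^ k) :
    ∀ x ∈ Set.Ioo (0 : ℝ) 1,
      DifferentiableAt ℝ Y x ∧ DifferentiableAt ℝ (deriv Y) x ∧
      147 * x * (x - 1) * (x + 1) * deriv (deriv Y) x
        + (266 * x ^ 2 - 42 * x - 98) * deriv Y x
        + (20 * x - 5) * Y x = 0 := by
  have habc : ∀ k : ℕ, (k : ℝ) ≠ -(5 / 42) ∧ (k : ℝ) ≠ -(11 / 42) ∧ (k : ℝ) ≠ -(2 / 3) := by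
    intro k
    have hk : (0 : ℝ) ≤ k := k.cast_nonneg
    refine ⟨?_, ?_, ?_⟩ <;> intro h <;> linarith
  obtain ⟨F₁, F₂, hF⟩ := exists_hasDerivAt_ordinaryHypergeometric habc
  set F : ℝ → ℝ := ₂F₁ (5 / 42 : ℝ) (11 / 42 : ℝ) (2 / 3 : ℝ) with hFdef
  set P : ℝ → ℝ := fun x => (x + 1) ^ (-(5 : ℝ) / 21) with hPdef
  set g : ℝ → ℝ := fun x => 4 * x / (x + 1) ^ 2 with hgdef
  have hYF : Y = fun x => P x * F (g x) := by
    rw [hY]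
    funext x
    simp only [hPdef, hgdef, hFdef, ordinaryHypergeometric_eq_tsum, smul_eq_mul]
    congr 1
    refine tsum_congr fun k => ?_
    rw [div_eq_mul_inv, mul_inv]
    ring
  have hg_lt : ∀ x ∈ Set.Ioo (0 : ℝ) 1, |g x| < 1 := by
    rintro x ⟨hx0, hx1⟩
    have hg0 : 0 ≤ g x := by positivity
    rw [abs_of_nonneg hg0, hgdef, div_lt_one (by positivity)]
    nlinarith [mul_pos (sub_pos.2 hx1) (sub_pos.2 hx1)]
  have hg' : ∀ x ∈ Set.Ioo (0 : ℝ) 1, HasDerivAt g (4 * (1 - x) / (x + 1) ^ 3) x := by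
    rintro x ⟨hx0, -⟩
    have hx : x + 1 ≠ 0 := by positivity
    refine (((hasDerivAt_id' x).const_mul 4).fun_div (((hasDerivAt_id' x).add_const 1).fun_pow 2)
      (pow_ne_zero 2 hx)).congr_deriv ?_
    field_simp
    push_cast
    ring
  have hP' : ∀ x ∈ Set.Ioo (0 : ℝ) 1, HasDerivAt P (P x * (-5 / 21 / (x + 1))) x := by
    rintro x ⟨hx0, -⟩
    have hx : x + 1 ≠ 0 := by positivity
    refine (((hasDerivAt_id' x).add_const 1).rpow_const (p := -(5 : ℝ) / 21)
      (Or.inl hx)).congr_deriv ?_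
    rw [Real.rpow_sub_one hx]
    ring
  set Y₁ : ℝ → ℝ := fun x =>
    P x * (-5 / 21 / (x + 1) * F (g x) + 4 * (1 - x) / (x + 1) ^ 3 * F₁ (g x)) with hY₁
  have hYd : ∀ x ∈ Set.Ioo (0 : ℝ) 1, HasDerivAt Y (Y₁ x) x := by
    intro x hx
    rw [hYF]
    refine ((hP' x hx).mul ((hF _ (hg_lt x hx)).1.comp x (hg' x hx))).congr_deriv ?_
    simp only [hY₁, Function.comp]
    ring
  intro x hx
  obtain ⟨hx0, hx1⟩ := hx
  have hx : x ∈ Set.Ioo (0 : ℝ) 1 := ⟨hx0, hx1⟩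
  have hne : x + 1 ≠ 0 := by positivity
  obtain ⟨hFx, hF₁x, hode⟩ := hF (g x) (hg_lt x hx)
  have hu : HasDerivAt (fun x : ℝ => -5 / 21 / (x + 1)) (5 / 21 / (x + 1) ^ 2) x := by
    refine ((hasDerivAt_const x (-5 / 21 : ℝ)).fun_div ((hasDerivAt_id' x).add_const 1)
      hne).congr_deriv ?_
    ring
  have hv : HasDerivAt (fun x : ℝ => 4 * (1 - x) / (x + 1) ^ 3) (8 * (x - 2) / (x + 1) ^ 4) x := by
    refine ((((hasDerivAt_id' x).const_sub 1).const_mul 4).fun_div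
      (((hasDerivAt_id' x).add_const 1).fun_pow 3) (pow_ne_zero 3 hne)).congr_deriv ?_
    field_simp
    push_cast
    ring
  have hY₁d := (hP' x hx).mul
    ((hu.mul (hFx.comp x (hg' x hx))).add (hv.mul (hF₁x.comp x (hg' x hx))))
  have hev : deriv Y =ᶠ[nhds x] Y₁ := by
    filter_upwards [isOpen_Ioo.mem_nhds hx] with y hy using (hYd y hy).deriv
  have hYdd := HasDerivAt.congr_of_eventuallyEq hY₁d hev
  refine ⟨(hYd x hx).differentiableAt, hYdd.differentiableAt, ?_⟩
  rw [hYdd.deriv, (hYd x hx).deriv, hYF]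
  simp only [hY₁, Function.comp, Pi.mul_apply, Pi.add_apply]
  have hgx : g x = 4 * x / (x + 1) ^ 2 := rfl
  generalize F (g x) = f₀ at *
  generalize F₁ (g x) = f₁ at *
  generalize F₂ (g x) = f₂ at *
  rw [hgx] at hode
  linear_combination (norm := (field_simp; ring)) (588 * (x - 1) / (x + 1) * P x) * hode
end

section
/- For x ∈ (−1/4, 1/4), let Y(x) = (4x³ + x² + x/2)·∑_{k=0}^∞ ((1/2)_k·(1/2)_k / ((1)_k·k!))·(16x²)^k + (32x⁵ − 2x³)·∑_{k=0}^∞ ((3/2)_k·(3/2)_k / ((2)_k·k!))·(16x²)^k. Then Y is twice differentiable on (−1/4, 1/4) and x²·(16x² − 1)·(16x³ + 24x² + 5x + 1)·Y''(x) − x·(512x⁵ + 384x⁴ − 64x³ − 88x² − 10x − 1)·Y'(x) + (512x⁵ + 64x⁴ − 128x³ − 60x² − 8x − 1)·Y(x) = 0 for all x ∈ (−1/4, 1/4). -/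
/-- The sum of the power series with coefficients `a`. -/
noncomputable def powerSum (a : ℕ → ℝ) (z : ℝ) : ℝ := ∑' k, a k * z ^ k

/-- The coefficients of the termwise derivative of a power series. -/
def derivCoeff (a : ℕ → ℝ) (k : ℕ) : ℝ := (k + 1) * a (k + 1)

/-- The sequence `a` grows at most polynomially. -/
def PolyBounded (a : ℕ → ℝ) : Prop := ∃ (C : ℝ) (m : ℕ), ∀ k : ℕ, |a k| ≤ C * (k + 1) ^ m

namespace PolyBounded

variable {a b : ℕ → ℝ}

lemma add (ha : PolyBounded a) (hb : PolyBounded b) : PolyBounded fun k => a k + b k := by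
  obtain ⟨C, m, hC⟩ := ha
  obtain ⟨C', m', hC'⟩ := hb
  have h0 : 0 ≤ C := by simpa using (abs_nonneg _).trans (hC 0)
  have h0' : 0 ≤ C' := by simpa using (abs_nonneg _).trans (hC' 0)
  refine ⟨C + C', m + m', fun k => ?_⟩
  have h1 : (1 : ℝ) ≤ k + 1 := by simp
  calc |a k + b k| ≤ |a k| + |b k| := abs_add_le _ _
    _ ≤ C * (k + 1) ^ m + C' * (k + 1) ^ m' := add_le_add (hC k) (hC' k)
    _ ≤ C * (k + 1) ^ (m + m') + C' * (k + 1) ^ (m + m') := by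
        gcongr <;> first | exact h1 | omega
    _ = (C + C') * (k + 1) ^ (m + m') := by ring

lemma const_mul (c : ℝ) (ha : PolyBounded a) : PolyBounded fun k => c * a k := by
  obtain ⟨C, m, hC⟩ := ha
  refine ⟨|c| * C, m, fun k => ?_⟩
  rw [abs_mul, mul_assoc]
  exact mul_le_mul_of_nonneg_left (hC k) (abs_nonneg c)

lemma natCast_mul (ha : PolyBounded a) : PolyBounded fun k => k * a k := by
  obtain ⟨C, m, hC⟩ := ha
  refine ⟨C, m + 1, fun k => ?_⟩
  rw [abs_mul, Nat.abs_cast, pow_succ]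
  have := hC k
  have h0 := abs_nonneg (a k)
  have hk : (0 : ℝ) ≤ k := k.cast_nonneg
  nlinarith

lemma succ (ha : PolyBounded a) : PolyBounded fun k => a (k + 1) := by
  obtain ⟨C, m, hC⟩ := ha
  have h0 : 0 ≤ C := by simpa using (abs_nonneg _).trans (hC 0)
  refine ⟨C * 2 ^ m, m, fun k => (hC (k + 1)).trans ?_⟩
  rw [mul_assoc, ← mul_pow]
  gcongr
  push_cast
  linarith [(k.cast_nonneg : (0 : ℝ) ≤ k)]

lemma derivCoeff (ha : PolyBounded a) : PolyBounded (derivCoeff a) := by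
  convert (ha.succ.natCast_mul.add ha.succ) using 2 with k
  simp only [_root_.derivCoeff]
  ring

lemma summable (ha : PolyBounded a) {z : ℝ} (hz : |z| < 1) : Summable fun k => a k * z ^ k := by
  obtain ⟨C, m, hC⟩ := ha
  have hs : Summable fun k : ℕ => ((k : ℝ) + 1) ^ m * |z| ^ k := by
    by_cases h : z = 0
    · subst h
      refine summable_of_ne_finset_zero (s := {0}) fun k hk => ?_
      have : k ≠ 0 := by simpa using hk
      simp [this]
    have h1 := (summable_nat_add_iff 1).2
      (summable_pow_mul_geometric_of_norm_lt_one (R := ℝ) m (r := |z|) (by simpa using hz))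
    refine (h1.mul_right |z|⁻¹).congr fun k => ?_
    have : |z| ≠ 0 := abs_ne_zero.2 h
    simp only [pow_succ, mul_assoc, mul_inv_cancel₀ this, mul_one, Nat.cast_succ]
  refine Summable.of_norm_bounded (hs.mul_left C) fun k => ?_
  rw [Real.norm_eq_abs, abs_mul, abs_pow, ← mul_assoc]
  exact mul_le_mul_of_nonneg_right (hC k) (by positivity)

lemma abs (ha : PolyBounded a) : PolyBounded fun k => |a k| := by
  simpa [PolyBounded] using ha

end PolyBounded

lemma mul_powerSum {a b : ℕ → ℝ} {z : ℝ} (ha : PolyBounded a) (hz : |z| < 1) (h0 : a 0 = 0)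
    (hb : ∀ k, a (k + 1) = b k) : z * powerSum b z = powerSum a z := by
  rw [powerSum, powerSum, (ha.summable hz).tsum_eq_zero_add, h0, zero_mul, zero_add,
    ← tsum_mul_left]
  refine tsum_congr fun k => ?_
  rw [hb]
  ring

lemma hasDerivAt_powerSum {a : ℕ → ℝ} (ha : PolyBounded a) {z : ℝ} (hz : |z| < 1) :
    HasDerivAt (powerSum a) (powerSum (derivCoeff a) z) z := by
  obtain ⟨r, hzr, hr1⟩ := exists_between hz
  have hr0 : 0 ≤ r := (abs_nonneg z).trans hzr.le
  have hu : Summable fun k : ℕ => |a k| * (k * r ^ (k - 1)) := by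
    rw [← summable_nat_add_iff 1]
    refine (ha.derivCoeff.abs.summable (z := r) (by rwa [abs_of_nonneg hr0])).congr fun k => ?_
    rw [derivCoeff, abs_mul, abs_of_nonneg (by positivity : (0 : ℝ) ≤ k + 1)]
    push_cast
    ring
  have hb : ∀ k : ℕ, ∀ y ∈ Metric.ball (0 : ℝ) r,
      ‖a k * (k * y ^ (k - 1))‖ ≤ |a k| * (k * r ^ (k - 1)) := by
    intro k y hy
    have hy : |y| ≤ r := by simpa using (mem_ball_zero_iff.1 hy).le
    rw [Real.norm_eq_abs, abs_mul, abs_mul, abs_pow, Nat.abs_cast]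
    gcongr
  have hmem : z ∈ Metric.ball (0 : ℝ) r := by simpa using hzr
  have h := hasDerivAt_tsum_of_isPreconnected (g := fun k y => a k * y ^ k) hu
    Metric.isOpen_ball (convex_ball (0 : ℝ) r).isPreconnected
    (fun k y _ => (hasDerivAt_pow k y).const_mul (a k)) hb hmem (ha.summable hz) hmem
  refine h.congr_deriv ?_
  have hs : Summable fun k : ℕ => a k * (k * z ^ (k - 1)) :=
    Summable.of_norm_bounded hu fun k => hb k z hmem
  rw [hs.tsum_eq_zero_add, powerSum]
  simp only [Nat.cast_zero, zero_mul, mul_zero, zero_add, derivCoeff]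
  refine tsum_congr fun k => ?_
  push_cast
  ring

/-- Gauss's hypergeometric differential equation, from the recurrence for the coefficients. -/
lemma powerSum_hypergeometric_eq {a : ℕ → ℝ} (α β γ : ℝ) (ha : PolyBounded a)
    (hrec : ∀ k : ℕ, ((k : ℝ) + 1) * (k + γ) * a (k + 1) = (k + α) * (k + β) * a k)
    {z : ℝ} (hz : |z| < 1) :
    z * (1 - z) * powerSum (derivCoeff (derivCoeff a)) z
      + (γ - (α + β + 1) * z) * powerSum (derivCoeff a) z - α * β * powerSum a z = 0 := by
  have hd := ha.derivCoeff
  have h1 : z * powerSum (derivCoeff a) z = powerSum (fun k => k * a k) z :=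
    mul_powerSum ha.natCast_mul hz (by simp) fun k => by simp [derivCoeff]
  have h2 : z * powerSum (derivCoeff (derivCoeff a)) z
      = powerSum (fun k => k * derivCoeff a k) z :=
    mul_powerSum hd.natCast_mul hz (by simp) fun k => by
      simp only [derivCoeff]; push_cast; ring
  have hq : PolyBounded fun k => k * (k * a k) + (-1) * (k * a k) :=
    ha.natCast_mul.natCast_mul.add (ha.natCast_mul.const_mul (-1))
  have h3 : z * powerSum (fun k => k * derivCoeff a k) z
      = powerSum (fun k => k * (k * a k) + (-1) * (k * a k)) z :=
    mul_powerSum hq hz (by simp) fun k => by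
      simp only [derivCoeff]; push_cast; ring
  have hsum : powerSum (fun k => k * derivCoeff a k) z
      - powerSum (fun k => k * (k * a k) + (-1) * (k * a k)) z
      + γ * powerSum (derivCoeff a) z - (α + β + 1) * powerSum (fun k => k * a k) z
      - α * β * powerSum a z = 0 := by
    have hs := ((((hd.natCast_mul.summable hz).hasSum.sub (hq.summable hz).hasSum).add
      ((hd.summable hz).hasSum.mul_left γ)).sub
      ((ha.natCast_mul.summable hz).hasSum.mul_left (α + β + 1))).sub
      ((ha.summable hz).hasSum.mul_left (α * β))
    refine hs.unique ?_
    convert hasSum_zero using 2 with k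
    simp only [derivCoeff]
    linear_combination z ^ k * hrec k
  linear_combination hsum + (1 - z) * h2 - h3 - (α + β + 1) * h1

/-- The coefficients of `₂F₁(1/2, 1/2; 1; z)`. -/
noncomputable def halfCoeff (k : ℕ) : ℝ :=
  (ascPochhammer ℝ k).eval (1 / 2) * (ascPochhammer ℝ k).eval (1 / 2)
    / ((ascPochhammer ℝ k).eval 1 * k.factorial)

lemma halfCoeff_rec (k : ℕ) :
    ((k : ℝ) + 1) * (k + 1) * halfCoeff (k + 1) = (k + 1 / 2) * (k + 1 / 2) * halfCoeff k := by
  have h1 : (ascPochhammer ℝ k).eval 1 ≠ 0 := (ascPochhammer_pos k 1 one_pos).ne'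
  have h2 : (k.factorial : ℝ) ≠ 0 := by positivity
  have h3 : (k : ℝ) + 1 ≠ 0 := by positivity
  have h4 : 1 + (k : ℝ) ≠ 0 := by positivity
  simp only [halfCoeff, ascPochhammer_succ_eval, Nat.factorial_succ]
  push_cast
  field_simp
  ring

lemma halfCoeff_nonneg (k : ℕ) : 0 ≤ halfCoeff k :=
  div_nonneg (mul_self_nonneg _)
    (mul_nonneg (ascPochhammer_pos k 1 one_pos).le k.factorial.cast_nonneg)

lemma polyBounded_halfCoeff : PolyBounded halfCoeff := by
  refine ⟨1, 0, fun k => ?_⟩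
  rw [abs_of_nonneg (halfCoeff_nonneg k)]
  induction k with
  | zero => simp [halfCoeff]
  | succ k ih =>
    have h := halfCoeff_rec k
    have h0 := halfCoeff_nonneg k
    have hk : (0 : ℝ) ≤ k := k.cast_nonneg
    have hle : ((k : ℝ) + 1) * (k + 1) * halfCoeff (k + 1) ≤ (k + 1) * (k + 1) * halfCoeff k := by
      rw [h]; gcongr <;> norm_num
    have := le_of_mul_le_mul_left hle (by positivity)
    simpa using this.trans ih

lemma derivCoeff_halfCoeff (k : ℕ) :
    4 * derivCoeff halfCoeff k =
      (ascPochhammer ℝ k).eval (3 / 2) * (ascPochhammer ℝ k).eval (3 / 2)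
        / ((ascPochhammer ℝ k).eval 2 * k.factorial) := by
  induction k with
  | zero =>
    have := halfCoeff_rec 0
    norm_num [derivCoeff, halfCoeff] at this ⊢
  | succ k ih =>
    have h := halfCoeff_rec (k + 1)
    have hd : 4 * derivCoeff halfCoeff (k + 1)
        = 4 * derivCoeff halfCoeff k * ((k + 3 / 2) * (k + 3 / 2) / ((k + 2) * (k + 1))) := by
      simp only [derivCoeff]
      push_cast at h ⊢
      field_simp
      linear_combination 4 * h
    have h1 : (ascPochhammer ℝ k).eval 2 ≠ 0 := (ascPochhammer_pos k 2 two_pos).ne'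
    have h2 : (k.factorial : ℝ) ≠ 0 := by positivity
    have h4 : 2 + (k : ℝ) ≠ 0 := by positivity
    rw [hd, ih]
    simp only [ascPochhammer_succ_eval, Nat.factorial_succ]
    push_cast
    field_simp
    ring

lemma derivCoeff_halfCoeff_rec (k : ℕ) :
    ((k : ℝ) + 1) * (k + 2) * derivCoeff halfCoeff (k + 1)
      = (k + 3 / 2) * (k + 3 / 2) * derivCoeff halfCoeff k := by
  have h := halfCoeff_rec (k + 1)
  simp only [derivCoeff]
  push_cast at h ⊢
  linear_combination (k + 1) * h

lemma hasDerivAt_powerSum_comp {a : ℕ → ℝ} (ha : PolyBounded a) {x : ℝ}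
    (hx : |16 * x ^ 2| < 1) :
    HasDerivAt (fun y => powerSum a (16 * y ^ 2))
      (powerSum (derivCoeff a) (16 * x ^ 2) * (32 * x)) x := by
  have h : HasDerivAt (fun y : ℝ => 16 * y ^ 2) (32 * x) x := by
    refine ((hasDerivAt_pow 2 x).const_mul (16 : ℝ)).congr_deriv ?_
    push_cast
    ring
  exact (hasDerivAt_powerSum ha hx).comp x h


theorem gauge_transformed_hypergeometric_solution
    (Y : ℝ → ℝ)
    (hY : Y = fun x : ℝ =>
      (4 * x ^ 3 + x ^ 2 + x / 2) * ∑' k : ℕ,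
        (Polynomial.eval ((1 : ℝ)/2) (ascPochhammer ℝ k)
            * Polynomial.eval ((1 : ℝ)/2) (ascPochhammer ℝ k)
          / (Polynomial.eval (1 : ℝ) (ascPochhammer ℝ k) * (Nat.factorial k : ℝ)))
          * (16 * x ^ 2) ^ k
      + (32 * x ^ 5 - 2 * x ^ 3) * ∑' k : ℕ,
        (Polynomial.eval ((3 : ℝ)/2) (ascPochhammer ℝ k)
            * Polynomial.eval ((3 : ℝ)/2) (ascPochhammer ℝ k)
          / (Polynomial.eval (2 : ℝ) (ascPochhammer ℝ k) * (Nat.factorial k : ℝ)))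
          * (16 * x ^ 2) ^ k) :
    ∀ x ∈ Set.Ioo (-(1 : ℝ)/4) (1/4),
      DifferentiableAt ℝ Y x ∧ DifferentiableAt ℝ (deriv Y) x ∧
      x ^ 2 * (16 * x ^ 2 - 1) * (16 * x ^ 3 + 24 * x ^ 2 + 5 * x + 1) * deriv (deriv Y) x
        - x * (512 * x ^ 5 + 384 * x ^ 4 - 64 * x ^ 3 - 88 * x ^ 2 - 10 * x - 1) * deriv Y x
        + (512 * x ^ 5 + 64 * x ^ 4 - 128 * x ^ 3 - 60 * x ^ 2 - 8 * x - 1) * Y x = 0 := by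
  set F : ℕ → ℝ := halfCoeff with hF
  have b0 : PolyBounded F := polyBounded_halfCoeff
  have b1 := b0.derivCoeff
  have b2 := b1.derivCoeff
  have hY' : Y = fun x : ℝ => (4 * x ^ 3 + x ^ 2 + x / 2) * powerSum F (16 * x ^ 2)
      + (128 * x ^ 5 - 8 * x ^ 3) * powerSum (derivCoeff F) (16 * x ^ 2) := by
    rw [hY]
    funext x
    simp only [← derivCoeff_halfCoeff, mul_assoc, tsum_mul_left, powerSum, hF, halfCoeff]
    ring
  have hunit : ∀ x ∈ Set.Ioo (-(1 : ℝ) / 4) (1 / 4), |16 * x ^ 2| < 1 := by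
    rintro x ⟨h1, h2⟩
    rw [abs_of_nonneg (by positivity)]
    nlinarith
  let Y₁ : ℝ → ℝ := fun x => (12 * x ^ 2 + 2 * x + 1 / 2) * powerSum F (16 * x ^ 2)
    + ((128 * x ^ 4 + 32 * x ^ 3 + 16 * x ^ 2) + (640 * x ^ 4 - 24 * x ^ 2))
      * powerSum (derivCoeff F) (16 * x ^ 2)
    + (4096 * x ^ 6 - 256 * x ^ 4) * powerSum (derivCoeff (derivCoeff F)) (16 * x ^ 2)
  have hd1 : ∀ x ∈ Set.Ioo (-(1 : ℝ) / 4) (1 / 4), HasDerivAt Y (Y₁ x) x := by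
    intro x hx
    have e0 := hasDerivAt_powerSum_comp b0 (hunit x hx)
    have e1 := hasDerivAt_powerSum_comp b1 (hunit x hx)
    have p0 : HasDerivAt (fun x : ℝ => 4 * x ^ 3 + x ^ 2 + x / 2)
        (12 * x ^ 2 + 2 * x + 1 / 2) x := by
      refine ((((hasDerivAt_pow 3 x).const_mul 4).add (hasDerivAt_pow 2 x)).add
        ((hasDerivAt_id x).div_const 2)).congr_deriv ?_
      push_cast; ring
    have p1 : HasDerivAt (fun x : ℝ => 128 * x ^ 5 - 8 * x ^ 3)
        (640 * x ^ 4 - 24 * x ^ 2) x := by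
      refine (((hasDerivAt_pow 5 x).const_mul 128).sub ((hasDerivAt_pow 3 x).const_mul 8)).congr_deriv ?_
      push_cast; ring
    rw [hY']
    refine ((p0.mul e0).add (p1.mul e1)).congr_deriv ?_
    simp only [Y₁]
    ring
  intro x hx
  have hz := hunit x hx
  have e0 := hasDerivAt_powerSum_comp b0 hz
  have e1 := hasDerivAt_powerSum_comp b1 hz
  have e2 := hasDerivAt_powerSum_comp b2 hz
  have q0 : HasDerivAt (fun x : ℝ => 12 * x ^ 2 + 2 * x + 1 / 2) (24 * x + 2) x := by
    refine ((((hasDerivAt_pow 2 x).const_mul 12).add ((hasDerivAt_id x).const_mul 2)).add_const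
      (1 / 2 : ℝ)).congr_deriv ?_
    push_cast; ring
  have q1 : HasDerivAt (fun x : ℝ =>
      (128 * x ^ 4 + 32 * x ^ 3 + 16 * x ^ 2) + (640 * x ^ 4 - 24 * x ^ 2))
      (3072 * x ^ 3 + 96 * x ^ 2 - 16 * x) x := by
    refine (((((hasDerivAt_pow 4 x).const_mul 128).add ((hasDerivAt_pow 3 x).const_mul 32)).add
      ((hasDerivAt_pow 2 x).const_mul 16)).add
      (((hasDerivAt_pow 4 x).const_mul 640).sub ((hasDerivAt_pow 2 x).const_mul 24))).congr_deriv ?_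
    push_cast; ring
  have q2 : HasDerivAt (fun x : ℝ => 4096 * x ^ 6 - 256 * x ^ 4)
      (24576 * x ^ 5 - 1024 * x ^ 3) x := by
    refine (((hasDerivAt_pow 6 x).const_mul 4096).sub ((hasDerivAt_pow 4 x).const_mul 256)).congr_deriv ?_
    push_cast; ring
  have hd2 := ((q0.mul e0).add (q1.mul e1)).add (q2.mul e2)
  have heq : deriv Y =ᶠ[nhds x] Y₁ := by
    filter_upwards [isOpen_Ioo.mem_nhds hx] with y hy using (hd1 y hy).deriv
  have hd2' := HasDerivAt.congr_of_eventuallyEq hd2 heq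
  refine ⟨(hd1 x hx).differentiableAt, hd2'.differentiableAt, ?_⟩
  rw [hd2'.deriv, (hd1 x hx).deriv, hY']
  have o1 := powerSum_hypergeometric_eq (1 / 2) (1 / 2) 1 b0 halfCoeff_rec hz
  have o2 := powerSum_hypergeometric_eq (3 / 2) (3 / 2) 2 b1 derivCoeff_halfCoeff_rec hz
  simp only [Y₁]
  generalize powerSum F (16 * x ^ 2) = f₀ at *
  generalize powerSum (derivCoeff F) (16 * x ^ 2) = f₁ at *
  generalize powerSum (derivCoeff (derivCoeff F)) (16 * x ^ 2) = f₂ at *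
  generalize powerSum (derivCoeff (derivCoeff (derivCoeff F))) (16 * x ^ 2) = f₃ at *
  linear_combination (-144 * x ^ 4 - 2368 * x ^ 5 - 7424 * x ^ 6 - 19456 * x ^ 7 - 8192 * x ^ 8) * o1
    - 512 * x ^ 5 * (16 * x ^ 2 - 1) * (16 * x ^ 3 + 24 * x ^ 2 + 5 * x + 1) * o2
end
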